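/- Let m ≥ 1 and n > m be integers, μ > 0 and λ* > 0 reals, and set r* = λ*/μ, ρ* = r*/m, and φ* = λ*·B_{m,n}(r*). Define θ : {0,1,…,n−1} → ℝ by the PI index formulas: θ(x) = B_{m,n}(r*)/B_x(r*) for 0 ≤ x ≤ m; θ(x) = B_{m,n}(r*)·(1 − ρ* + ρ*·(1 − (ρ*)^{x−m})·B_m(r*)) / ((ρ*)^{x−m}·(1 − ρ*)·B_m(r*)) for m < x < n if ρ* ≠ 1; and θ(x) = B_{m,n}(m)·[x − m + 1/B_m(m)] for m < x < n if ρ* = 1. Then θ satisfies the first-order linear recursion: φ* − λ*·θ(0) = 0, and φ* − λ*·θ(x) + min(x,m)·μ·θ(x−1) = 0 for every integer x with 1 ≤ x < n. -/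

import Mathlib

/-- `a_j(r)` coefficients of the M/M/m/n queue. -/
noncomputable def aCoef (m j : ℕ) (r : ℝ) : ℝ :=
  if j ≤ m then r ^ j / (Nat.factorial j : ℝ)
  else (r ^ m / (Nat.factorial m : ℝ)) * (r / (m : ℝ)) ^ (j - m)

/-- Blocking probability `B_{m,n}(r)` of the M/M/m/n queue with offered load `r`. -/
noncomputable def Bmn (m n : ℕ) (r : ℝ) : ℝ :=
  aCoef m n r / ∑ j ∈ Finset.range (n + 1), aCoef m j r

/-- Mean number in system `L_{m,n}(r)` of the M/M/m/n queue with offered load `r`. -/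
noncomputable def Lmn (m n : ℕ) (r : ℝ) : ℝ :=
  (∑ j ∈ Finset.range (n + 1), (j : ℝ) * aCoef m j r) /
    ∑ j ∈ Finset.range (n + 1), aCoef m j r

/-- Erlang-B formula `B_m(r)`. -/
noncomputable def erlangB (m : ℕ) (r : ℝ) : ℝ :=
  (r ^ m / (Nat.factorial m : ℝ)) / ∑ j ∈ Finset.range (m + 1), r ^ j / (Nat.factorial j : ℝ)

open Classical in
/-- PI routing index `θ^{PI}(x)` for a queue with `m` servers, buffer size `n`,
and offered load `r`. -/
noncomputable def piIndex (m n : ℕ) (r : ℝ) (x : ℕ) : ℝ :=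
  if x ≤ m then Bmn m n r / erlangB x r
  else if r / (m : ℝ) = 1 then Bmn m n r * ((x : ℝ) - (m : ℝ) + 1 / erlangB m r)
  else Bmn m n r *
      (1 - r / (m : ℝ) + (r / (m : ℝ)) * (1 - (r / (m : ℝ)) ^ (x - m)) * erlangB m r) /
    ((r / (m : ℝ)) ^ (x - m) * (1 - r / (m : ℝ)) * erlangB m r)

theorem erlangB_pos_aux (x : ℕ) (r : ℝ) (hr : 0 < r) : 0 < erlangB x r := by
  unfold erlangB
  have : 0 < ∑ j ∈ Finset.range (x + 1), r ^ j / (Nat.factorial j : ℝ) :=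
    Finset.sum_pos (fun j _ => by positivity) ⟨0, by simp⟩
  positivity

theorem erlangB_rec_aux (x : ℕ) (r : ℝ) (hr : 0 < r) :
    r * (1 / erlangB (x + 1) r) = r + ((x : ℝ) + 1) * (1 / erlangB x r) := by
  unfold erlangB
  rw [Finset.sum_range_succ _ (x + 1)]
  have : 0 < ∑ j ∈ Finset.range (x + 1), r ^ j / (Nat.factorial j : ℝ) :=
    Finset.sum_pos (fun j _ => by positivity) ⟨0, by simp⟩
  generalize (∑ j ∈ Finset.range (x + 1), r ^ j / (Nat.factorial j : ℝ)) = S at *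
  have hf : (0 : ℝ) < Nat.factorial x := by positivity
  rw [Nat.factorial_succ]
  push_cast
  field_simp
  ring

theorem piIndex_ge_aux (m n : ℕ) (r : ℝ) (hr : 0 < r) (hm : 1 ≤ m) (k : ℕ) :
    piIndex m n r (m + k) = if r / (m : ℝ) = 1 then Bmn m n r * ((k : ℝ) + 1 / erlangB m r)
      else Bmn m n r *
      (1 - r / (m : ℝ) + (r / (m : ℝ)) * (1 - (r / (m : ℝ)) ^ k) * erlangB m r) /
    ((r / (m : ℝ)) ^ k * (1 - r / (m : ℝ)) * erlangB m r) := by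
  have hb := erlangB_pos_aux m r hr
  rcases Nat.eq_zero_or_pos k with rfl | hk
  · simp only [piIndex, add_zero, le_refl, if_true]
    split_ifs with h
    · simp [div_eq_mul_inv]
    · have : 1 - r / (m : ℝ) ≠ 0 := fun h' => h (by linarith)
      generalize r / (m : ℝ) = ρ at *
      simp only [pow_zero, sub_self, mul_zero, zero_mul, add_zero, one_mul]
      field_simp
  · have h1 : ¬ (m + k ≤ m) := by omega
    simp only [piIndex, h1, if_false, Nat.add_sub_cancel_left]
    push_cast
    simp

theorem stmt_19 (m n : ℕ) (hm : 1 ≤ m) (hn : m < n) (μ lam : ℝ) (hμ : 0 < μ) (hlam : 0 < lam)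
    (r : ℝ) (hr : r = lam / μ) (ρ : ℝ) (hρ : ρ = r / (m : ℝ))
    (φs : ℝ) (hφs : φs = lam * Bmn m n r) :
    φs - lam * piIndex m n r 0 = 0 ∧
    ∀ x : ℕ, 1 ≤ x → x < n →
      φs - lam * piIndex m n r x + ((min x m : ℕ) : ℝ) * μ * piIndex m n r (x - 1) = 0 := by
  have hr0 : 0 < r := by rw [hr]; positivity
  have hl : lam = r * μ := by rw [hr]; field_simp
  have hm0 : (0 : ℝ) < m := by exact_mod_cast hm
  refine ⟨by simp [piIndex, erlangB, hφs], ?_⟩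
  intro x hx _
  subst hφs
  rcases Nat.lt_or_ge m x with h | h
  · obtain ⟨k, rfl⟩ : ∃ k, x = m + (k + 1) := ⟨x - m - 1, by omega⟩
    have e : m + (k + 1) - 1 = m + k := by omega
    rw [e, piIndex_ge_aux m n r hr0 hm, piIndex_ge_aux m n r hr0 hm, min_eq_right h.le, hl]
    have hb := erlangB_pos_aux m r hr0
    have hrm : r = ρ * m := by rw [hρ]; field_simp
    have hρ0 : 0 < ρ := by rw [hρ]; positivity
    rw [← hρ]
    generalize erlangB m r = b at *
    generalize Bmn m n r = B at *
    split_ifs with h1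
    · rw [hrm, h1]
      push_cast
      ring
    · have : 1 - ρ ≠ 0 := fun h' => h1 (by linarith)
      rw [hrm, pow_succ]
      field_simp
      ring
  · obtain ⟨y, rfl⟩ : ∃ y, x = y + 1 := ⟨x - 1, by omega⟩
    have h2 : y ≤ m := by omega
    have := erlangB_rec_aux y r hr0
    simp only [piIndex, h, if_true, Nat.add_sub_cancel, h2, min_eq_left h]
    rw [hl]
    push_cast
    linear_combination (-μ * Bmn m n r) * this
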